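/- If inf T = a_1 > −∞, then for all q₁, q₂ ∈ (0,1) with q₁ < q₂, the difference μ_{q₂}(x) − μ_{q₁}(x) converges to (σ/ρ)·(Φ⁻¹(q₂) − Φ⁻¹(q₁)) as x → −∞. -/

import Mathlib

open MeasureTheory ProbabilityTheory Set Filter Topology

noncomputable def stdphi (x : ℝ) : ℝ := Real.exp (-(x ^ 2) / 2) / Real.sqrt (2 * Real.pi)

noncomputable def stdPhi (x : ℝ) : ℝ := ∫ t in Iic x, stdphi t

noncomputable def stdPhiInv : ℝ → ℝ := Function.invFun stdPhi

noncomputable def stdPhiE (c : EReal) (x s : ℝ) : ℝ :=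
  if c = ⊤ then 1 else if c = ⊥ then 0 else stdPhi ((c.toReal - x) / s)

def truncOrdered {k : ℕ} (a b : Fin k → EReal) : Prop :=
  (∀ i, a i < b i) ∧ ∀ i j : Fin k, i < j → b i < a j

def truncSet {k : ℕ} (a b : Fin k → EReal) : Set ℝ :=
  {x : ℝ | ∃ i, a i < (x : EReal) ∧ (x : EReal) < b i}

noncomputable def truncSum {k : ℕ} (a b : Fin k → EReal) (s x : ℝ) : ℝ :=
  ∑ i, (stdPhiE (b i) x s - stdPhiE (a i) x s)

noncomputable def condPDF {k : ℕ} (a b : Fin k → EReal) (σ τ μ x : ℝ) : ℝ :=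
  (1 / σ) * stdphi ((x - μ) / σ) * truncSum a b τ x
    / truncSum a b (Real.sqrt (σ ^ 2 + τ ^ 2)) μ

noncomputable def Fmu {k : ℕ} (a b : Fin k → EReal) (σ τ μ x : ℝ) : ℝ :=
  ∫ u in Iic x, condPDF a b σ τ μ u

/-- `G_μ(x,v) = Φ((x - (ρ²μ + (1-ρ²)v))/(σρ))` with `ρ² = τ²/(σ²+τ²)`. -/
noncomputable def Gfun (σ τ μ x v : ℝ) : ℝ :=
  stdPhi ((x - (τ ^ 2 / (σ ^ 2 + τ ^ 2) * μ + (1 - τ ^ 2 / (σ ^ 2 + τ ^ 2)) * v)) /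
    (σ * Real.sqrt (τ ^ 2 / (σ ^ 2 + τ ^ 2))))

/-- `G_μ(x,v)` for an extended-real `v`, with the natural conventions at `±∞`. -/
noncomputable def GfunE (σ τ μ x : ℝ) (c : EReal) : ℝ :=
  if c = ⊤ then 0 else if c = ⊥ then 1 else Gfun σ τ μ x c.toReal

/-- `h(v)` from Lemma `le_dmu_formula`. -/
noncomputable def hfun {k : ℕ} (a b : Fin k → EReal) (σ τ μ v : ℝ) : ℝ :=
  (1 / Real.sqrt (σ ^ 2 + τ ^ 2)) * stdphi ((v - μ) / Real.sqrt (σ ^ 2 + τ ^ 2)) /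
    truncSum a b (Real.sqrt (σ ^ 2 + τ ^ 2)) μ

/-- `h(v)` for an extended-real `v`, with the convention `φ(±∞) = 0`. -/
noncomputable def hfunE {k : ℕ} (a b : Fin k → EReal) (σ τ μ : ℝ) (c : EReal) : ℝ :=
  if c = ⊤ then 0 else if c = ⊥ then 0 else hfun a b σ τ μ c.toReal

/-- `l(x,v)` from Lemma `le_dens_dx`. -/
noncomputable def lfun {k : ℕ} (a b : Fin k → EReal) (τ x v : ℝ) : ℝ :=
  (1 / τ) * stdphi ((v - x) / τ) / truncSum a b τ x

/-- `l(x,v)` for an extended-real `v`, with the convention `φ(±∞) = 0`. -/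
noncomputable def lfunE {k : ℕ} (a b : Fin k → EReal) (τ x : ℝ) (c : EReal) : ℝ :=
  if c = ⊤ then 0 else if c = ⊥ then 0 else lfun a b τ x c.toReal

/-- The function `B_μ(x)` from the proof of Proposition 1. -/
noncomputable def Bfun {k : ℕ} (a b : Fin k → EReal) (σ τ μ x : ℝ) : ℝ :=
  Real.sqrt (τ ^ 2 / (σ ^ 2 + τ ^ 2)) / σ * stdphi (stdPhiInv (Fmu a b σ τ μ x))
    - condPDF a b σ τ μ x
    + ∑ i, (hfunE a b σ τ μ (b i) * (Fmu a b σ τ μ x - GfunE σ τ μ x (b i))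
        - hfunE a b σ τ μ (a i) * (Fmu a b σ τ μ x - GfunE σ τ μ x (a i)))

lemma stdphi_eq_gaussianPDFReal : stdphi = gaussianPDFReal 0 1 := by
  ext x
  simp [stdphi, gaussianPDFReal, div_eq_inv_mul]

lemma stdphi_pos (x : ℝ) : 0 < stdphi x := by
  unfold stdphi
  positivity

lemma integrable_stdphi : Integrable stdphi := by
  rw [stdphi_eq_gaussianPDFReal]
  exact ProbabilityTheory.integrable_gaussianPDFReal 0 1

lemma integral_stdphi : ∫ x, stdphi x = 1 := by
  rw [stdphi_eq_gaussianPDFReal]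
  exact ProbabilityTheory.integral_gaussianPDFReal_eq_one 0 one_ne_zero

lemma stdphi_neg (x : ℝ) : stdphi (-x) = stdphi x := by
  simp [stdphi]

lemma stdPhi_sub (x y : ℝ) : stdPhi y - stdPhi x = ∫ t in x..y, stdphi t :=
  intervalIntegral.integral_Iic_sub_Iic integrable_stdphi.integrableOn
    integrable_stdphi.integrableOn

lemma strictMono_stdPhi : StrictMono stdPhi := by
  intro x y hxy
  have h := intervalIntegral.intervalIntegral_pos_of_pos
    (integrable_stdphi.intervalIntegrable (a := x) (b := y)) stdphi_pos hxy
  rw [← stdPhi_sub] at h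
  linarith

lemma continuous_stdPhi : Continuous stdPhi := by
  have h : stdPhi = fun y => stdPhi 0 + ∫ t in (0 : ℝ)..y, stdphi t := by
    ext y
    rw [← stdPhi_sub]
    ring
  rw [h]
  exact continuous_const.add
    (intervalIntegral.continuous_primitive (fun _ _ => integrable_stdphi.intervalIntegrable) 0)

lemma stdPhi_neg (x : ℝ) : stdPhi (-x) = 1 - stdPhi x := by
  have h1 : stdPhi (-x) = ∫ t in Ioi x, stdphi t := by
    have h := integral_comp_neg_Iic (-x) stdphi
    simp only [stdphi_neg, neg_neg] at h
    exact h
  have h2 := integral_add_compl (measurableSet_Iic (a := x)) integrable_stdphi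
  rw [compl_Iic, integral_stdphi, ← h1] at h2
  unfold stdPhi at *
  linarith

lemma stdPhi_nonneg (x : ℝ) : 0 ≤ stdPhi x :=
  integral_nonneg fun t => (stdphi_pos t).le

lemma stdPhi_le_one (x : ℝ) : stdPhi x ≤ 1 := by
  have := stdPhi_nonneg (-x)
  rw [stdPhi_neg] at this
  linarith

lemma tendsto_stdPhi_atBot : Tendsto stdPhi atBot (𝓝 0) :=
  tendsto_integral_Iic_zero tendsto_id

lemma tendsto_stdPhi_atTop : Tendsto stdPhi atTop (𝓝 1) := by
  have h := (tendsto_const_nhds (x := (1 : ℝ))).sub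
    (tendsto_stdPhi_atBot.comp tendsto_neg_atTop_atBot)
  refine (sub_zero (1 : ℝ) ▸ h).congr fun x => ?_
  simp [stdPhi_neg]

lemma stdPhi_stdPhiInv {q : ℝ} (hq : q ∈ Ioo (0 : ℝ) 1) : stdPhi (stdPhiInv q) = q := by
  obtain ⟨x, hx⟩ := (tendsto_stdPhi_atBot.eventually (gt_mem_nhds hq.1)).exists
  obtain ⟨y, hy⟩ := (tendsto_stdPhi_atTop.eventually (lt_mem_nhds hq.2)).exists
  exact Function.invFun_eq
    (mem_range_of_exists_le_of_exists_ge continuous_stdPhi ⟨x, hx.le⟩ ⟨y, hy.le⟩)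

/-- The density at `v` of the normal distribution with mean `m` and standard deviation `s`. -/
noncomputable def normalDensity (s m v : ℝ) : ℝ := 1 / s * stdphi ((v - m) / s)

lemma normalDensity_pos {s : ℝ} (hs : 0 < s) (m v : ℝ) : 0 < normalDensity s m v :=
  mul_pos (by positivity) (stdphi_pos _)

lemma integrable_normalDensity {s : ℝ} (hs : 0 < s) (m : ℝ) :
    Integrable (normalDensity s m) :=
  ((integrable_stdphi.comp_div hs.ne').comp_sub_right m).const_mul (1 / s)

lemma integral_comp_normalize {s : ℝ} (hs : 0 < s) (m : ℝ) (f : ℝ → ℝ) :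
    ∫ v, 1 / s * f ((v - m) / s) = ∫ t, f t := by
  rw [integral_const_mul, integral_sub_right_eq_self (fun v => f (v / s)) m,
    Measure.integral_comp_div, abs_of_pos hs, smul_eq_mul]
  field_simp

lemma integral_normalDensity {s : ℝ} (hs : 0 < s) (m : ℝ) : ∫ v, normalDensity s m v = 1 := by
  rw [← integral_stdphi]
  exact integral_comp_normalize hs m stdphi

lemma setIntegral_normalDensity_Iic {s : ℝ} (hs : 0 < s) (m x : ℝ) :
    ∫ v in Iic x, normalDensity s m v = stdPhi ((x - m) / s) := by
  unfold stdPhi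
  rw [← integral_indicator measurableSet_Iic, ← integral_indicator measurableSet_Iic]
  refine Eq.trans ?_ (integral_comp_normalize hs m _)
  congr 1 with v
  simp [indicator_apply, normalDensity, div_le_div_iff_of_pos_right hs]

lemma setIntegral_normalDensity_le {s : ℝ} (hs : 0 < s) (m : ℝ) (c : EReal) :
    ∫ v in {v : ℝ | (v : EReal) ≤ c}, normalDensity s m v = stdPhiE c m s := by
  induction c using EReal.rec with
  | bot => simp [stdPhiE]
  | top => simp [stdPhiE, integral_normalDensity hs]
  | coe r =>
    simp only [EReal.coe_le_coe_iff, stdPhiE, EReal.coe_ne_top, EReal.coe_ne_bot, if_false,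
      EReal.toReal_coe]
    exact setIntegral_normalDensity_Iic hs m r

lemma setIntegral_normalDensity_lt {s : ℝ} (hs : 0 < s) (m : ℝ) (c : EReal) :
    ∫ v in {v : ℝ | (v : EReal) < c}, normalDensity s m v = stdPhiE c m s := by
  induction c using EReal.rec with
  | bot => simp [stdPhiE]
  | top => simp [stdPhiE, EReal.coe_lt_top, integral_normalDensity hs]
  | coe r =>
    simp only [EReal.coe_lt_coe_iff, stdPhiE, EReal.coe_ne_top, EReal.coe_ne_bot, if_false,
      EReal.toReal_coe]
    rw [← setIntegral_normalDensity_Iic hs m r, integral_Iic_eq_integral_Iio]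
    rfl

lemma measurableSet_coe_lt (c : EReal) : MeasurableSet {v : ℝ | (v : EReal) < c} :=
  measurableSet_lt measurable_coe_real_ereal measurable_const

lemma measurableSet_coe_le (c : EReal) : MeasurableSet {v : ℝ | (v : EReal) ≤ c} :=
  measurableSet_le measurable_coe_real_ereal measurable_const

lemma truncSet_eq_iUnion {k : ℕ} (a b : Fin k → EReal) :
    truncSet a b = ⋃ i, {v : ℝ | (v : EReal) < b i} \ {v : ℝ | (v : EReal) ≤ a i} := by
  ext v
  simp [truncSet, and_comm]

lemma measurableSet_truncSet {k : ℕ} (a b : Fin k → EReal) : MeasurableSet (truncSet a b) := by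
  rw [truncSet_eq_iUnion]
  exact MeasurableSet.iUnion fun i => (measurableSet_coe_lt _).diff (measurableSet_coe_le _)

lemma setIntegral_normalDensity_truncSet {k : ℕ} {a b : Fin k → EReal} (hab : truncOrdered a b)
    {s : ℝ} (hs : 0 < s) (m : ℝ) :
    ∫ v in truncSet a b, normalDensity s m v = truncSum a b s m := by
  rw [truncSet_eq_iUnion, integral_iUnion_fintype
    (fun i => (measurableSet_coe_lt _).diff (measurableSet_coe_le _)) _
    (fun i => (integrable_normalDensity hs m).integrableOn)]
  · refine Finset.sum_congr rfl fun i _ => ?_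
    rw [setIntegral_sdiff (measurableSet_coe_le _) (integrable_normalDensity hs m).integrableOn,
      setIntegral_normalDensity_lt hs, setIntegral_normalDensity_le hs]
    exact fun v (hv : (v : EReal) ≤ a i) => hv.trans_lt (hab.1 i)
  · have key : ∀ i j : Fin k, i < j → Disjoint
        ({v : ℝ | (v : EReal) < b i} \ {v : ℝ | (v : EReal) ≤ a i})
        ({v : ℝ | (v : EReal) < b j} \ {v : ℝ | (v : EReal) ≤ a j}) := by
      intro i j hij
      refine Set.disjoint_left.2 fun v hvi hvj => hvj.2 ?_
      exact (lt_trans hvi.1 (hab.2 i j hij)).le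
    intro i j hij
    rcases lt_or_gt_of_ne hij with h | h
    · exact key i j h
    · exact (key j i h).symm

lemma integrable_normalDensity_mul {σ τ : ℝ} (hσ : 0 < σ) (hτ : 0 < τ) (μ : ℝ) :
    Integrable (fun p : ℝ × ℝ => normalDensity σ μ p.1 * normalDensity τ p.1 p.2)
      ((volume : Measure ℝ).prod volume) := by
  have h := ((integrable_normalDensity hσ μ).convolution_integrand (ContinuousLinearMap.mul ℝ ℝ)
    (integrable_normalDensity hτ 0)).swap
  refine h.congr (Eventually.of_forall fun p => ?_)
  simp [normalDensity]

/-- The joint density of `(X, X + U)` factors through the conditional law of `X` given `X + U`. -/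
lemma normalDensity_mul_normalDensity {σ τ ρ : ℝ} (hσ : 0 < σ) (hτ : 0 < τ) (hρ : 0 < ρ)
    (hρ2 : ρ ^ 2 = τ ^ 2 / (σ ^ 2 + τ ^ 2)) (μ u v : ℝ) :
    normalDensity σ μ u * normalDensity τ u v =
      normalDensity (Real.sqrt (σ ^ 2 + τ ^ 2)) μ v *
        normalDensity (σ * ρ) (ρ ^ 2 * μ + (1 - ρ ^ 2) * v) u := by
  set s := Real.sqrt (σ ^ 2 + τ ^ 2) with hs
  have hs0 : 0 < s := Real.sqrt_pos.2 (by positivity)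
  have hs2 : s ^ 2 = σ ^ 2 + τ ^ 2 := Real.sq_sqrt (by positivity)
  have hρs : τ = s * ρ := by
    have : τ ^ 2 = (s * ρ) ^ 2 := by rw [mul_pow, hρ2, hs2]; field_simp
    exact (pow_left_inj₀ hτ.le (by positivity) two_ne_zero).1 this
  have hexp : -((u - μ) / σ) ^ 2 / 2 + -((v - u) / τ) ^ 2 / 2 = -((v - μ) / s) ^ 2 / 2 +
      -((u - (ρ ^ 2 * μ + (1 - ρ ^ 2) * v)) / (σ * ρ)) ^ 2 / 2 := by
    have hσ2 : σ ^ 2 = s ^ 2 * (1 - ρ ^ 2) := by rw [hρs] at hs2; linarith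
    have h1 : 1 - ρ ^ 2 ≠ 0 := fun h => by rw [h] at hσ2; nlinarith
    simp only [div_pow, mul_pow]
    rw [hσ2, hρs]
    field_simp
    ring
  have hexp' := congrArg Real.exp hexp
  rw [Real.exp_add, Real.exp_add] at hexp'
  unfold normalDensity stdphi
  have hc : 1 / σ * (1 / τ) = 1 / s * (1 / (σ * ρ)) := by rw [hρs]; field_simp
  calc _ = (1 / σ * (1 / τ)) * (Real.exp (-((u - μ) / σ) ^ 2 / 2) *
        Real.exp (-((v - u) / τ) ^ 2 / 2)) / (√(2 * Real.pi)) ^ 2 := by ring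
    _ = _ := by rw [hc, hexp']; ring

lemma truncSum_mul_Fmu {k : ℕ} {a b : Fin k → EReal} (hab : truncOrdered a b)
    {σ τ ρ : ℝ} (hσ : 0 < σ) (hτ : 0 < τ) (hρ : 0 < ρ)
    (hρ2 : ρ ^ 2 = τ ^ 2 / (σ ^ 2 + τ ^ 2)) (μ x : ℝ)
    (hD : truncSum a b (Real.sqrt (σ ^ 2 + τ ^ 2)) μ ≠ 0) :
    truncSum a b (Real.sqrt (σ ^ 2 + τ ^ 2)) μ * Fmu a b σ τ μ x =
      ∫ v in truncSet a b, normalDensity (Real.sqrt (σ ^ 2 + τ ^ 2)) μ v *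
        stdPhi ((x - (ρ ^ 2 * μ + (1 - ρ ^ 2) * v)) / (σ * ρ)) := by
  have h1 : truncSum a b (Real.sqrt (σ ^ 2 + τ ^ 2)) μ * Fmu a b σ τ μ x =
      ∫ u in Iic x, ∫ v in truncSet a b, normalDensity σ μ u * normalDensity τ u v := by
    unfold Fmu
    rw [← integral_const_mul]
    refine integral_congr_ae (Eventually.of_forall fun u => ?_)
    simp only [condPDF]
    rw [integral_const_mul, setIntegral_normalDensity_truncSet hab hτ, mul_div_cancel₀ _ hD]
    rfl
  rw [h1, integral_integral_swap]
  · refine integral_congr_ae (Eventually.of_forall fun v => ?_)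
    simp only [normalDensity_mul_normalDensity hσ hτ hρ hρ2]
    rw [integral_const_mul, setIntegral_normalDensity_Iic (mul_pos hσ hρ)]
  · rw [Measure.prod_restrict]
    exact (integrable_normalDensity_mul hσ hτ μ).restrict

lemma normalDensity_change_mean {s : ℝ} (hs : 0 < s) (μ m v : ℝ) :
    normalDensity s μ v =
      Real.exp (-(2 * (v - m) * (m - μ) + (m - μ) ^ 2) / (2 * s ^ 2)) * normalDensity s m v := by
  have h : -((v - μ) / s) ^ 2 / 2 =
      -(2 * (v - m) * (m - μ) + (m - μ) ^ 2) / (2 * s ^ 2) + -((v - m) / s) ^ 2 / 2 := by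
    field_simp
    ring
  unfold normalDensity stdphi
  rw [h, Real.exp_add]
  ring

lemma setIntegral_normalDensity_Ioo_pos {s : ℝ} (hs : 0 < s) (m : ℝ) {x y : ℝ} (hxy : x < y) :
    0 < ∫ v in Ioo x y, normalDensity s m v := by
  rw [← integral_Ioc_eq_integral_Ioo, ← intervalIntegral.integral_of_le hxy.le]
  exact intervalIntegral.intervalIntegral_pos_of_pos
    (integrable_normalDensity hs m).intervalIntegrable (normalDensity_pos hs m) hxy

lemma setIntegral_normalDensity_mono {s : ℝ} (hs : 0 < s) (m : ℝ) {A B : Set ℝ} (h : A ⊆ B) :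
    ∫ v in A, normalDensity s m v ≤ ∫ v in B, normalDensity s m v :=
  setIntegral_mono_set (integrable_normalDensity hs m).integrableOn
    (Eventually.of_forall fun v => (normalDensity_pos hs m v).le) h.eventuallyLE

/-- As the mean tends to `-∞`, a normal law conditioned on a set `T` that charges every right
neighbourhood of `α` puts vanishing mass beyond `α + ε`. -/
lemma tendsto_normal_tail_ratio {s : ℝ} (hs : 0 < s) {T : Set ℝ} {α β ε : ℝ} (hαβ : α < β)
    (hT : Ioo α β ⊆ T) (hε : 0 < ε) :
    Tendsto (fun μ => (∫ v in T ∩ Ici (α + ε), normalDensity s μ v) /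
      ∫ v in T, normalDensity s μ v) atBot (𝓝 0) := by
  obtain ⟨γ, hαγ, hγ⟩ := exists_between (lt_min hαβ (lt_add_of_pos_right α hε))
  have hγβ : γ < β := hγ.trans_le (min_le_left _ _)
  have hγε : γ < α + ε := hγ.trans_le (min_le_right _ _)
  set κ := ∫ v in Ioo α γ, normalDensity s α v with hκ
  have hκ0 : 0 < κ := setIntegral_normalDensity_Ioo_pos hs α hαγ
  have hden : ∀ μ ≤ α, Real.exp (-(2 * (γ - α) * (α - μ) + (α - μ) ^ 2) / (2 * s ^ 2)) * κ ≤
      ∫ v in T, normalDensity s μ v := by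
    intro μ hμ
    refine le_trans ?_ (setIntegral_normalDensity_mono hs μ
      ((Ioo_subset_Ioo_right hγβ.le).trans hT))
    rw [hκ, ← integral_const_mul]
    refine setIntegral_mono_on ((integrable_normalDensity hs α).const_mul _).integrableOn
      (integrable_normalDensity hs μ).integrableOn measurableSet_Ioo fun v hv => ?_
    rw [normalDensity_change_mean hs μ α v]
    refine mul_le_mul_of_nonneg_right (Real.exp_le_exp.2 ?_) (normalDensity_pos hs α v).le
    have : 0 ≤ α - μ := sub_nonneg.2 hμ
    have := hv.2.le
    gcongr
  have hnum : ∀ μ ≤ α, ∫ v in T ∩ Ici (α + ε), normalDensity s μ v ≤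
      Real.exp (-(2 * ε * (α - μ) + (α - μ) ^ 2) / (2 * s ^ 2)) := by
    intro μ hμ
    refine (setIntegral_normalDensity_mono hs μ inter_subset_right).trans ?_
    calc ∫ v in Ici (α + ε), normalDensity s μ v
        ≤ ∫ v in Ici (α + ε), Real.exp (-(2 * ε * (α - μ) + (α - μ) ^ 2) / (2 * s ^ 2)) *
            normalDensity s α v := by
          refine setIntegral_mono_on (integrable_normalDensity hs μ).integrableOn
            ((integrable_normalDensity hs α).const_mul _).integrableOn measurableSet_Ici
            fun v hv => ?_
          rw [normalDensity_change_mean hs μ α v]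
          refine mul_le_mul_of_nonneg_right (Real.exp_le_exp.2 ?_) (normalDensity_pos hs α v).le
          have h1 : 0 ≤ α - μ := sub_nonneg.2 hμ
          have h2 : ε ≤ v - α := by linarith [mem_Ici.1 hv]
          gcongr
      _ ≤ _ := by
          rw [integral_const_mul]
          refine mul_le_of_le_one_right (Real.exp_pos _).le ?_
          refine (setIntegral_normalDensity_mono hs α (subset_univ _)).trans_eq ?_
          rw [setIntegral_univ, integral_normalDensity hs]
  have hlim : Tendsto (fun μ => Real.exp ((ε - (γ - α)) / s ^ 2 * (μ - α)) / κ) atBot (𝓝 0) := by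
    rw [← zero_div κ]
    refine (Real.tendsto_exp_atBot.comp ?_).div_const κ
    refine Tendsto.const_mul_atBot (div_pos (by linarith) (by positivity)) ?_
    exact tendsto_atBot_add_const_right _ _ tendsto_id
  refine squeeze_zero' (Eventually.of_forall fun μ => ?_) ?_ hlim
  · exact div_nonneg (integral_nonneg fun v => (normalDensity_pos hs μ v).le)
      (integral_nonneg fun v => (normalDensity_pos hs μ v).le)
  · filter_upwards [eventually_le_atBot α] with μ hμ
    refine (div_le_div₀ (Real.exp_pos _).le (hnum μ hμ) (by positivity) (hden μ hμ)).trans_eq ?_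
    rw [← div_div, ← Real.exp_sub]
    congr 2
    field_simp
    ring

lemma truncSet_subset_Ioi {k : ℕ} {a b : Fin (k + 1) → EReal} (hab : truncOrdered a b) {α : ℝ}
    (hα : a 0 = α) : truncSet a b ⊆ Ioi α := by
  rintro v ⟨i, hi, -⟩
  have h : a 0 ≤ a i := by
    rcases eq_or_ne i 0 with rfl | h
    · exact le_rfl
    · exact ((hab.1 0).trans (hab.2 0 i (Fin.pos_of_ne_zero h))).le
  exact EReal.coe_lt_coe_iff.1 (hα ▸ h.trans_lt hi)

lemma exists_Ioo_subset_truncSet {k : ℕ} {a b : Fin (k + 1) → EReal} (hab : truncOrdered a b)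
    {α : ℝ} (hα : a 0 = α) : ∃ β, α < β ∧ Ioo α β ⊆ truncSet a b := by
  obtain ⟨β, h1, h2⟩ := EReal.lt_iff_exists_real_btwn.1 (hab.1 0)
  refine ⟨β, EReal.coe_lt_coe_iff.1 (hα ▸ h1), fun v hv => ⟨0, ?_, ?_⟩⟩
  · rw [hα]
    exact EReal.coe_lt_coe_iff.2 hv.1
  · exact (EReal.coe_lt_coe_iff.2 hv.2).trans h2

/-- The standardized quantile curve converges to the corresponding normal quantile. -/
lemma tendsto_standardized_quantile {k : ℕ} {a b : Fin (k + 1) → EReal}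
    (hab : truncOrdered a b) {α : ℝ} (hα : a 0 = α)
    {σ τ ρ : ℝ} (hσ : 0 < σ) (hτ : 0 < τ) (hρ : 0 < ρ) (hρ2 : ρ ^ 2 = τ ^ 2 / (σ ^ 2 + τ ^ 2))
    {m : ℝ → ℝ} {q : ℝ} (hq : q ∈ Ioo (0 : ℝ) 1) (hm : ∀ x, Fmu a b σ τ (m x) x = 1 - q) :
    Tendsto (fun x => (x - (ρ ^ 2 * m x + (1 - ρ ^ 2) * α)) / (σ * ρ)) atBot
      (𝓝 (-stdPhiInv q)) := by
  set s := Real.sqrt (σ ^ 2 + τ ^ 2) with hs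
  have hs0 : 0 < s := Real.sqrt_pos.2 (by positivity)
  obtain ⟨β, hαβ, hβ⟩ := exists_Ioo_subset_truncSet hab hα
  set T := truncSet a b with hTdef
  have hTm : MeasurableSet T := measurableSet_truncSet a b
  have hTα : T ⊆ Ioi α := truncSet_subset_Ioi hab hα
  have hσρ : 0 < σ * ρ := mul_pos hσ hρ
  have hρ1 : 0 < 1 - ρ ^ 2 := by
    rw [hρ2, sub_pos, div_lt_one (by positivity)]
    nlinarith
  set G : ℝ → ℝ → ℝ := fun x v => stdPhi ((x - (ρ ^ 2 * m x + (1 - ρ ^ 2) * v)) / (σ * ρ))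
    with hG
  have hGanti : ∀ x, Antitone (G x) := by
    intro x v w hvw
    refine strictMono_stdPhi.monotone ?_
    gcongr
  have hDpos : ∀ μ, 0 < ∫ v in T, normalDensity s μ v := fun μ =>
    (setIntegral_normalDensity_Ioo_pos hs0 μ hαβ).trans_le (setIntegral_normalDensity_mono hs0 μ hβ)
  have hGint : ∀ x, Integrable (fun v => normalDensity s (m x) v * G x v) := by
    intro x
    refine (integrable_normalDensity hs0 (m x)).mul_bdd (c := 1) ?_ ?_
    · exact (hGanti x).measurable.aestronglyMeasurable
    · refine Eventually.of_forall fun v => ?_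
      rw [Real.norm_of_nonneg (stdPhi_nonneg _)]
      exact stdPhi_le_one _
  have hF : ∀ x, (∫ v in T, normalDensity s (m x) v) * (1 - q) =
      ∫ v in T, normalDensity s (m x) v * G x v := by
    intro x
    have hD := setIntegral_normalDensity_truncSet hab hs0 (m x)
    rw [← hm x, hD]
    exact truncSum_mul_Fmu hab hσ hτ hρ hρ2 (m x) x (hD ▸ (hDpos (m x)).ne')
  set y := stdPhiInv q with hy
  have hΦy : stdPhi (-y) = 1 - q := by rw [stdPhi_neg, stdPhi_stdPhiInv hq]
  set z : ℝ → ℝ := fun x => (x - (ρ ^ 2 * m x + (1 - ρ ^ 2) * α)) / (σ * ρ) with hz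
  have hzlb : ∀ x, -y ≤ z x := by
    intro x
    rw [← strictMono_stdPhi.le_iff_le, hΦy]
    refine le_of_mul_le_mul_left ?_ (hDpos (m x))
    rw [hF x, ← integral_mul_const]
    refine setIntegral_mono_on (hGint x).integrableOn
      ((integrable_normalDensity hs0 (m x)).mul_const _).integrableOn hTm fun v hv => ?_
    exact mul_le_mul_of_nonneg_left (hGanti x (hTα hv).le) (normalDensity_pos hs0 _ _).le
  have hmlim : Tendsto m atBot atBot := by
    refine tendsto_atBot_mono (f := fun x => (x + (σ * ρ * y - (1 - ρ ^ 2) * α)) / ρ ^ 2) ?_ ?_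
    · intro x
      have h := hzlb x
      rw [hz, le_div_iff₀ hσρ] at h
      rw [le_div_iff₀ (by positivity)]
      linarith
    · exact (tendsto_atBot_add_const_right _ _ tendsto_id).atBot_div_const (by positivity)
  rw [tendsto_order]
  refine ⟨fun w hw => Eventually.of_forall fun x => hw.trans_le (hzlb x), fun w hw => ?_⟩
  set c := (1 - ρ ^ 2) / (σ * ρ) with hc
  have hc0 : 0 < c := div_pos hρ1 hσρ
  obtain ⟨w', hyw, hww⟩ := exists_between hw
  set ε := (w - w') / c with hεdef
  have hε : 0 < ε := div_pos (sub_pos.2 hww) hc0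
  have hcε : c * ε = w - w' := by rw [hεdef]; field_simp
  have hgap : 0 < stdPhi w' - (1 - q) := by
    rw [← hΦy]
    exact sub_pos.2 (strictMono_stdPhi hyw)
  have htail := (tendsto_normal_tail_ratio hs0 hαβ hβ hε).comp hmlim
  filter_upwards [htail.eventually (gt_mem_nhds hgap)] with x hx
  set N := ∫ v in T ∩ Ici (α + ε), normalDensity s (m x) v with hN
  set D := ∫ v in T, normalDensity s (m x) v with hD
  have hx' : N < (stdPhi w' - (1 - q)) * D := (div_lt_iff₀ (hDpos (m x))).1 hx
  have hN0 : 0 ≤ N := integral_nonneg fun v => (normalDensity_pos hs0 _ v).le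
  have hlow : G x (α + ε) * (D - N) ≤ D * (1 - q) := by
    have hsplit : D - N = ∫ v in T \ (T ∩ Ici (α + ε)), normalDensity s (m x) v :=
      (setIntegral_sdiff (hTm.inter measurableSet_Ici)
        (integrable_normalDensity hs0 _).integrableOn inter_subset_left).symm
    rw [hF x, hsplit, mul_comm, ← integral_mul_const]
    refine le_trans (setIntegral_mono_on
      ((integrable_normalDensity hs0 (m x)).mul_const _).integrableOn (hGint x).integrableOn
      (hTm.diff (hTm.inter measurableSet_Ici)) fun v hv => ?_)
      (setIntegral_mono_set (hGint x).integrableOn ?_ sdiff_subset.eventuallyLE)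
    · refine mul_le_mul_of_nonneg_left (hGanti x ?_) (normalDensity_pos hs0 _ _).le
      by_contra h
      exact hv.2 ⟨hv.1, (not_le.1 h).le⟩
    · exact Eventually.of_forall fun v =>
        mul_nonneg (normalDensity_pos hs0 _ _).le (stdPhi_nonneg _)
  have hGz : G x (α + ε) = stdPhi (z x - c * ε) := by
    simp only [hG, hz, hc]
    congr 1
    field_simp
    ring
  have hG1 : G x (α + ε) ≤ 1 := stdPhi_le_one _
  have hlt : G x (α + ε) < stdPhi w' := by
    refine lt_of_mul_lt_mul_right ?_ (hDpos (m x)).le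
    nlinarith
  rw [hGz, strictMono_stdPhi.lt_iff_lt, hcε] at hlt
  linarith

/-- Theorem 1 (sharpness as `x → -∞` when `inf T = a₁ > -∞`). -/
theorem stmt2 {k : ℕ} (a b : Fin (k + 1) → EReal) (hab : truncOrdered a b)
    (ha1 : a 0 ≠ ⊥)
    (σ τ ρ : ℝ) (hσ : 0 < σ) (hτ : 0 < τ)
    (hρ : 0 < ρ) (hρ2 : ρ ^ 2 = τ ^ 2 / (σ ^ 2 + τ ^ 2))
    (μq : ℝ → ℝ → ℝ)
    (hμq : ∀ q ∈ Ioo (0 : ℝ) 1, ∀ x : ℝ, Fmu a b σ τ (μq q x) x = 1 - q)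
    (q₁ q₂ : ℝ) (hq₁ : q₁ ∈ Ioo (0 : ℝ) 1) (hq₂ : q₂ ∈ Ioo (0 : ℝ) 1)
    (hq : q₁ < q₂) :
    Tendsto (fun x => μq q₂ x - μq q₁ x) atBot
      (𝓝 (σ / ρ * (stdPhiInv q₂ - stdPhiInv q₁))) := by
  obtain ⟨α, hα⟩ : ∃ α : ℝ, a 0 = α :=
    ⟨(a 0).toReal, (EReal.coe_toReal ((hab.1 0).trans_le le_top).ne ha1).symm⟩
  have h₁ := tendsto_standardized_quantile hab hα hσ hτ hρ hρ2 hq₁ (hμq q₁ hq₁)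
  have h₂ := tendsto_standardized_quantile hab hα hσ hτ hρ hρ2 hq₂ (hμq q₂ hq₂)
  have h := (h₁.sub h₂).const_mul (σ / ρ)
  rw [show σ / ρ * (-stdPhiInv q₁ - -stdPhiInv q₂) =
    σ / ρ * (stdPhiInv q₂ - stdPhiInv q₁) by ring] at h
  refine h.congr fun x => ?_
  field_simp
  ring
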